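/- arXiv:1608.05008 — 4 statements merged into one kernel-verified Lean document; each statement's English description precedes it below -/
import Mathlib

section
/- For every ν ≥ 1, the multiplication map U_1 × ⋯ × U_ν × F_{2^m}^* → F_{2^n}^* is a group isomorphism; in particular every x ∈ F_{2^n}^* can be written uniquely as x = u_1⋯u_ν·y with u_i ∈ U_i for 1 ≤ i ≤ ν and y ∈ F_{2^m}^* (polar decomposition). -/
open Finset

/-- In a commutative monoid, an element killed by `(2j+1)(2j+3)` is uniquely the product of
an element killed by `2j+3` and an element killed by `2j+1`. -/
theorem existsUnique_mul_of_pow_eq_one {M : Type*} [CommMonoid M] (j : ℕ) (x : M)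
    (hx : x ^ ((2 * j + 1) * (2 * j + 3)) = 1) :
    ∃! p : M × M, p.1 ^ (2 * j + 3) = 1 ∧ p.2 ^ (2 * j + 1) = 1 ∧ x = p.1 * p.2 := by
  refine ⟨(x ^ ((j + 1) * (2 * j + 1)), x ^ ((j + 1) * (2 * j + 3))), ⟨?_, ?_, ?_⟩, ?_⟩
  · rw [← pow_mul, mul_assoc, mul_comm (j + 1), pow_mul, hx, one_pow]
  · rw [← pow_mul, mul_assoc, mul_comm (2 * j + 3), mul_comm (j + 1), pow_mul, hx, one_pow]
  · have h : (j + 1) * (2 * j + 1) + (j + 1) * (2 * j + 3) =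
        (2 * j + 1) * (2 * j + 3) + 1 := by ring
    rw [← pow_add, h, pow_succ, hx, one_mul]
  · rintro ⟨u, z⟩ ⟨hu, hz, rfl⟩
    dsimp only at hu hz ⊢
    have h₁ : (j + 1) * (2 * j + 1) = (2 * j + 3) * j + 1 := by ring
    have h₂ : (j + 1) * (2 * j + 3) = (2 * j + 1) * (j + 2) + 1 := by ring
    refine Prod.ext (Eq.symm ?_) (Eq.symm ?_) <;> dsimp only
    · rw [mul_pow, mul_comm (j + 1), pow_mul z, hz, one_pow, mul_one, mul_comm (2 * j + 1), h₁,
        pow_succ, pow_mul, hu, one_pow, one_mul]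
    · rw [mul_pow, mul_comm (j + 1), pow_mul u, hu, one_pow, one_mul, mul_comm (2 * j + 3), h₂,
        pow_succ, pow_mul, hz, one_pow, one_mul]

theorem exists_two_pow_eq_and_two_pow_succ_sub_one (ν : ℕ) {m : ℕ} (hm : m ≠ 0) :
    ∃ j, 2 ^ (2 ^ ν * m) = 2 * j + 2 ∧
      2 ^ (2 ^ (ν + 1) * m) - 1 = (2 * j + 1) * (2 * j + 3) := by
  obtain ⟨k, hk⟩ := Nat.exists_eq_succ_of_ne_zero (Nat.mul_ne_zero (pow_ne_zero ν two_ne_zero) hm)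
  obtain ⟨j, hj⟩ := Nat.exists_eq_succ_of_ne_zero (pow_ne_zero k (two_ne_zero (α := ℕ)))
  have h : 2 ^ (2 ^ ν * m) = 2 * j + 2 := by rw [hk, pow_succ, hj]; omega
  refine ⟨j, h, ?_⟩
  rw [pow_succ 2 ν, mul_right_comm, pow_mul, h]
  exact Nat.sub_eq_of_eq_add (by ring)

/-- The product of polar factors is killed by `2 ^ (2 ^ ν * m) - 1`. -/
theorem prod_mul_pow_two_pow_sub_one {M : Type*} [CommMonoid M] {m : ℕ} (hm : m ≠ 0) (ν : ℕ)
    (u : Fin ν → M) (y : M)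
    (hu : ∀ i : Fin ν, u i ^ (2 ^ (2 ^ (ν - 1 - (i : ℕ)) * m) + 1) = 1)
    (hy : y ^ (2 ^ m - 1) = 1) :
    ((∏ i, u i) * y) ^ (2 ^ (2 ^ ν * m) - 1) = 1 := by
  induction ν with
  | zero => simpa using hy
  | succ ν ih =>
    obtain ⟨j, hj, hj'⟩ := exists_two_pow_eq_and_two_pow_succ_sub_one ν hm
    have h₀ := hu 0
    have ht := ih (fun i => u i.succ) fun i => by
      have := hu i.succ
      rwa [Fin.val_succ, show ν + 1 - 1 - ((i : ℕ) + 1) = ν - 1 - i by omega] at this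
    simp only [Fin.val_zero, Nat.add_sub_cancel, Nat.sub_zero, hj] at h₀
    rw [hj] at ht
    rw [hj', Fin.prod_univ_succ, mul_assoc, mul_pow, pow_mul _ _ (2 * j + 3),
      pow_mul (_ * y), show 2 * j + 1 = 2 * j + 2 - 1 from rfl, ht, one_pow, mul_one,
      ← pow_mul, mul_comm, pow_mul, h₀, one_pow]

/-- Polar decomposition in a commutative monoid. -/
theorem existsUnique_polar_of_pow_eq_one {M : Type*} [CommMonoid M] {m : ℕ} (hm : m ≠ 0) (ν : ℕ)
    (x : M) (hx : x ^ (2 ^ (2 ^ ν * m) - 1) = 1) :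
    ∃! p : (Fin ν → M) × M,
      (∀ i : Fin ν, p.1 i ^ (2 ^ (2 ^ (ν - 1 - (i : ℕ)) * m) + 1) = 1) ∧
      p.2 ^ (2 ^ m - 1) = 1 ∧ x = (∏ i, p.1 i) * p.2 := by
  induction ν generalizing x with
  | zero =>
    refine ⟨(Fin.elim0, x), ⟨fun i => i.elim0, by simpa using hx, by simp⟩, ?_⟩
    rintro ⟨u, y⟩ ⟨-, -, rfl⟩
    exact Prod.ext (Subsingleton.elim _ _) (by simp)
  | succ ν ih =>
    obtain ⟨j, hj, hj'⟩ := exists_two_pow_eq_and_two_pow_succ_sub_one ν hm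
    have hsub (i : Fin ν) : ν + 1 - 1 - (i.succ : ℕ) = ν - 1 - i := by
      rw [Fin.val_succ]; omega
    rw [hj'] at hx
    obtain ⟨⟨u₀, z⟩, ⟨hu₀, hz, rfl⟩, huniq⟩ := existsUnique_mul_of_pow_eq_one j x hx
    obtain ⟨⟨u, y⟩, ⟨hu, hy, rfl⟩, huniq'⟩ := ih z (by rw [hj]; exact hz)
    refine ⟨(Fin.cons u₀ u, y), ⟨?_, hy, ?_⟩, ?_⟩
    · refine Fin.cases ?_ fun i => ?_
      · simpa [hj] using hu₀
      · rw [hsub]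
        exact hu i
    · simp [Fin.prod_univ_succ, mul_assoc]
    · rintro ⟨v, w⟩ ⟨hv, hw, he⟩
      dsimp only at hv hw he
      have hv₀ := hv 0
      simp only [Fin.val_zero, Nat.add_sub_cancel, Nat.sub_zero, hj] at hv₀
      have hvt (i : Fin ν) : v i.succ ^ (2 ^ (2 ^ (ν - 1 - (i : ℕ)) * m) + 1) = 1 := by
        rw [← hsub]
        exact hv i.succ
      have ht := prod_mul_pow_two_pow_sub_one hm ν (fun i => v i.succ) w hvt hw
      rw [hj] at ht
      have h₁ := huniq (v 0, (∏ i : Fin ν, v i.succ) * w)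
        ⟨hv₀, ht, by rw [he, Fin.prod_univ_succ, mul_assoc]⟩
      rw [Prod.mk.injEq] at h₁
      have h₂ := huniq' (fun i => v i.succ, w) ⟨hvt, hw, h₁.2.symm⟩
      rw [Prod.mk.injEq] at h₂
      refine Prod.ext ?_ h₂.2
      rw [← h₁.1, ← h₂.1]
      exact (Fin.cons_self_tail v).symm

theorem pow_sub_one_eq_one_iff {F : Type*} [Field F] {q : ℕ} (hq : 1 < q) (y : F) :
    y ^ (q - 1) = 1 ↔ y ^ q = y ∧ y ≠ 0 := by
  obtain ⟨k, rfl⟩ := Nat.exists_eq_add_of_lt hq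
  constructor
  · intro h
    have hy : y ≠ 0 := by
      rintro rfl
      simp at h
    refine ⟨?_, hy⟩
    rw [show 1 + k + 1 = (1 + k + 1 - 1) + 1 from rfl, pow_succ, h, one_mul]
  · rintro ⟨h, hy⟩
    rw [pow_succ] at h
    exact mul_right_cancel₀ hy (by rw [one_mul]; exact h)

/-- Polar decomposition: for `n = 2^ν·m` with `ν ≥ 1` and `m` odd, the multiplication map
`U_1 × ⋯ × U_ν × F_{2^m}^* → F_{2^n}^*` is a group isomorphism (here expressed as a
bijection, the map being multiplication); in particular every `x ∈ F_{2^n}^*` can be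
written uniquely as `x = u_1⋯u_ν·y` with `u_i ∈ U_i` and `y ∈ F_{2^m}^*`, where `U_i` is
the subgroup of `(2^{m_i}+1)`-th roots of unity and `m_i = 2^{ν-i}·m`. -/
theorem polar_decomposition
    {F : Type*} [Field F] [Fintype F]
    (n ν m : ℕ) (hν : 1 ≤ ν) (hm : Odd m) (hn : n = 2 ^ ν * m)
    (hF : Fintype.card F = 2 ^ n) :
    Set.BijOn (fun p : (Fin ν → F) × F => (∏ i, p.1 i) * p.2)
      {p : (Fin ν → F) × F |
        (∀ i : Fin ν, p.1 i ^ (2 ^ (2 ^ (ν - 1 - (i : ℕ)) * m) + 1) = 1) ∧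
        p.2 ^ 2 ^ m = p.2 ∧ p.2 ≠ 0}
      {x : F | x ≠ 0} ∧
    ∀ x : F, x ≠ 0 →
      ∃! p : (Fin ν → F) × F,
        (∀ i : Fin ν, p.1 i ^ (2 ^ (2 ^ (ν - 1 - (i : ℕ)) * m) + 1) = 1) ∧
        (p.2 ^ 2 ^ m = p.2 ∧ p.2 ≠ 0) ∧
        x = (∏ i, p.1 i) * p.2 := by
  have hm₀ : m ≠ 0 := hm.pos.ne'
  have key : ∀ x : F, x ≠ 0 →
      ∃! p : (Fin ν → F) × F,
        (∀ i : Fin ν, p.1 i ^ (2 ^ (2 ^ (ν - 1 - (i : ℕ)) * m) + 1) = 1) ∧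
        (p.2 ^ 2 ^ m = p.2 ∧ p.2 ≠ 0) ∧
        x = (∏ i, p.1 i) * p.2 := by
    intro x hx
    have h := FiniteField.pow_card_sub_one_eq_one x hx
    rw [hF, hn] at h
    simpa only [pow_sub_one_eq_one_iff (Nat.one_lt_two_pow hm₀)] using
      existsUnique_polar_of_pow_eq_one hm₀ ν x h
  have hmaps (p : (Fin ν → F) × F)
      (hp : ∀ i : Fin ν, p.1 i ^ (2 ^ (2 ^ (ν - 1 - (i : ℕ)) * m) + 1) = 1)
      (hp₂ : p.2 ≠ 0) : (∏ i, p.1 i) * p.2 ≠ 0 := by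
    refine mul_ne_zero (Finset.prod_ne_zero_iff.2 fun i _ h => ?_) hp₂
    have := hp i
    simp [h] at this
  refine ⟨⟨fun p hp => hmaps p hp.1 hp.2.2, ?_, ?_⟩, key⟩
  · intro p hp q hq h
    exact (key _ (hmaps p hp.1 hp.2.2)).unique ⟨hp.1, hp.2, rfl⟩ ⟨hq.1, hq.2, h⟩
  · intro x hx
    obtain ⟨p, ⟨h₁, h₂, h₃⟩, -⟩ := key x hx
    exact ⟨p, ⟨h₁, h₂⟩, h₃.symm⟩
end

section
/- Let a ∈ F_{2^n}^* be written as a = α·ã with α ∈ U_1 and ã ∈ F_{2^{m_1}}^* via the polar decomposition, let α̃ ∈ U_1 be a square root of α, and set β = χ_n(α)^{-1} ∈ F_4^*. Then for every b ∈ F_4^* and every ω ∈ F_{2^n}: W_{f_{a,b}}(ω) = W_{f_{ã, β·b}}(α̃·ω). -/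
open Finset

attribute [local instance] Classical.propDecidable

noncomputable section

/-- The absolute trace `Tr^k` of `GF(2^k)`, as a function on an ambient field of
characteristic two containing `GF(2^k)`. -/
def absTr {F : Type*} [Field F] (k : ℕ) (x : F) : F :=
  ∑ i ∈ Finset.range k, x ^ 2 ^ i

/-- The relative field trace `Tr^k_j` from `GF(2^k)` to `GF(2^j)`. -/
def relTr {F : Type*} [Field F] (k j : ℕ) (x : F) : F :=
  ∑ i ∈ Finset.range (k / j), x ^ 2 ^ (j * i)

/-- `(-1)^b` for `b ∈ F_2`, viewed inside an ambient field of characteristic two. -/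
def sgn {F : Type*} [Field F] (b : F) : ℤ := if b = 0 then 1 else -1

/-- The subfield `GF(2^k)` of the ambient field, as a finset. -/
def gf (F : Type*) [Field F] [Fintype F] (k : ℕ) : Finset F :=
  Finset.univ.filter fun x => x ^ 2 ^ k = x

/-- The trace of `F_4` down to `F_2`, `tr_2(y) = y + y²`. -/
def tr2 {F : Type*} [Field F] (y : F) : F := y + y ^ 2

/-- The cubic multiplicative character `χ_k(x) = x^((2^k-1)/3)` of `GF(2^k)`. -/
def chi {F : Type*} [Field F] (k : ℕ) (x : F) : F := x ^ ((2 ^ k - 1) / 3)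

/-- The Walsh transform at `ω` of a Boolean function on `GF(2^n)`
(with values in `F_2` inside the ambient field). -/
def walsh {F : Type*} [Field F] [Fintype F] (n : ℕ) (f : F → F) (ω : F) : ℤ :=
  ∑ x : F, sgn (f x + absTr n (ω * x))

/-- The binary Kloosterman sum `K_k(a)` (with the convention `0⁻¹ = 0`). -/
def kloo {F : Type*} [Field F] [Fintype F] (k : ℕ) (a : F) : ℤ :=
  ∑ x ∈ gf F k, sgn (absTr k (a * x + x⁻¹))

/-- The binary cubic sum `C_k(a,b)`. -/
def cub {F : Type*} [Field F] [Fintype F] (k : ℕ) (a b : F) : ℤ :=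
  ∑ x ∈ gf F k, sgn (absTr k (a * x ^ 3 + b * x))

/-- `f_a(x) = Tr^n(a · x^(2^{m₁}-1))`. -/
def fA {F : Type*} [Field F] (n m1 : ℕ) (a x : F) : F :=
  absTr n (a * x ^ (2 ^ m1 - 1))

/-- `g_b(x) = tr_2(b · χ_n(x))`. -/
def gB {F : Type*} [Field F] (n : ℕ) (b x : F) : F := tr2 (b * chi n x)

/-- The binomial Boolean function `f_{a,b} = f_a + g_b`. -/
def fAB {F : Type*} [Field F] (n m1 : ℕ) (a b x : F) : F :=
  fA n m1 a x + gB n b x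

/-- `U`, the image of `U_1 × ⋯ × U_ν` in `GF(2^n)^*` under multiplication, where
`U_i` is the subgroup of `(2^{m_i}+1)`-th roots of unity and `m_i = 2^{ν-i}·m`. -/
def bigU (F : Type*) [Field F] [Fintype F] (ν m : ℕ) : Finset F :=
  Finset.univ.filter fun u => ∃ c : Fin ν → F,
    (∀ i : Fin ν, c i ^ (2 ^ (2 ^ (ν - 1 - (i : ℕ)) * m) + 1) = 1) ∧ u = ∏ i, c i

/-- Writing `a = α·ã` with `α ∈ U_1`, `ã ∈ F_{2^{m₁}}^*`, taking `α̃ ∈ U_1` a square root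
of `α` and `β = χ_n(α)⁻¹ ∈ F_4^*`, one has `W_{f_{a,b}}(ω) = W_{f_{ã,β·b}}(α̃·ω)`. -/
theorem walsh_reduce_coefficient_field
    {F : Type*} [Field F] [Fintype F]
    (n ν m : ℕ) (hν : 1 ≤ ν) (hm : Odd m) (hn : n = 2 ^ ν * m)
    (hF : Fintype.card F = 2 ^ n)
    (a α atil αtil b β : F)
    (ha : a ≠ 0)
    (hα : α ^ (2 ^ (2 ^ (ν - 1) * m) + 1) = 1)
    (hatil : atil ^ 2 ^ (2 ^ (ν - 1) * m) = atil) (hatil0 : atil ≠ 0)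
    (hdec : a = α * atil)
    (hαtil : αtil ^ (2 ^ (2 ^ (ν - 1) * m) + 1) = 1) (hsq : αtil ^ 2 = α)
    (hβ : β = (chi n α)⁻¹)
    (hb : b ^ 3 = 1) (hb0 : b ≠ 0)
    (ω : F) :
    walsh n (fAB n (2 ^ (ν - 1) * m) a b) ω
      = walsh n (fAB n (2 ^ (ν - 1) * m) atil (β * b)) (αtil * ω) := by
  have hu0 : αtil ≠ 0 := by
    rintro rfl
    simp at hαtil
  have hu3 : chi n αtil ^ 3 = 1 := by
    have h3 : 3 ∣ 2 ^ n - 1 := by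
      obtain ⟨k, rfl⟩ := Nat.exists_eq_add_of_le hν
      have hn2 : n = 2 * (2 ^ k * m) := by rw [hn, pow_add, pow_one, mul_assoc]
      rw [hn2, pow_mul]
      simpa using Nat.sub_dvd_pow_sub_pow 4 1 (2 ^ k * m)
    rw [chi, ← pow_mul, Nat.div_mul_cancel h3, ← hF]
    exact FiniteField.pow_card_sub_one_eq_one αtil hu0
  have hβu : β = chi n αtil := by
    have h2 : chi n α = chi n αtil ^ 2 := by
      rw [chi, chi, ← hsq, ← pow_mul, ← pow_mul, mul_comm]
    rw [hβ, h2]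
    apply inv_eq_of_mul_eq_one_left
    rw [← hu3]
    ring
  have hpow : α * αtil ^ (2 ^ (2 ^ (ν - 1) * m) - 1) = 1 := by
    have hq : 0 < 2 ^ (2 ^ (ν - 1) * m) := by positivity
    rw [← hsq, ← pow_add, ← hαtil]
    congr 1
    omega
  unfold walsh
  refine (Fintype.sum_equiv (Equiv.mulLeft₀ αtil hu0) _ _ fun y => ?_).symm
  have hf : a * (αtil * y) ^ (2 ^ (2 ^ (ν - 1) * m) - 1)
      = atil * y ^ (2 ^ (2 ^ (ν - 1) * m) - 1) := by
    rw [hdec, mul_pow]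
    linear_combination atil * y ^ (2 ^ (2 ^ (ν - 1) * m) - 1) * hpow
  have hg : b * chi n (αtil * y) = β * b * chi n y := by
    rw [hβu, chi, chi, chi, mul_pow]
    ring
  have hω : ω * (αtil * y) = αtil * ω * y := by ring
  change _ = sgn (fAB n (2 ^ (ν - 1) * m) a b (αtil * y) + absTr n (ω * (αtil * y)))
  simp only [fAB, fA, gB, hf, hg, hω]
end
end

section
/- For ν ≥ 1, a ∈ F_{2^n}^*, b ∈ F_4^*, and every x ∈ F_{2^n}^* with polar decomposition x = u_1⋯u_ν·y (u_i ∈ U_i, y ∈ F_{2^m}^*), one has f_{a,b}(x) = f_a(u_1) + g_b(u_ν). -/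
open Finset

attribute [local instance] Classical.propDecidable

noncomputable section

theorem two_pow_add_one_dvd_of_lt {k l : ℕ} (m : ℕ) (h : k < l) :
    2 ^ (2 ^ k * m) + 1 ∣ 2 ^ (2 ^ l * m) - 1 := by
  have hsq : 2 ^ (2 ^ k * m) + 1 ∣ 2 ^ (2 ^ (k + 1) * m) - 1 := by
    have e : 2 ^ (k + 1) * m = 2 ^ k * m * 2 := by ring
    rw [e, pow_mul 2 (2 ^ k * m) 2]
    simpa using Nat.sq_sub_sq (2 ^ (2 ^ k * m)) 1 ▸ Dvd.intro _ rfl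
  exact hsq.trans (Nat.pow_sub_one_dvd_pow_sub_one 2
    (Nat.mul_dvd_mul_right (pow_dvd_pow 2 h) m))

theorem four_pow_mod_three (j : ℕ) : 4 ^ j % 3 = 1 := by
  simp [Nat.pow_mod]

theorem coprime_two_pow_even_add_one_three {k : ℕ} (hk : Even k) :
    Nat.Coprime (2 ^ k + 1) 3 := by
  obtain ⟨j, rfl⟩ := hk
  have e : 2 ^ (j + j) = 4 ^ j := by rw [← two_mul, pow_mul]; norm_num
  have := four_pow_mod_three j
  rw [Nat.coprime_comm, Nat.Prime.coprime_iff_not_dvd Nat.prime_three, e]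
  omega

theorem coprime_two_pow_odd_sub_one_three {k : ℕ} (hk : Odd k) :
    Nat.Coprime (2 ^ k - 1) 3 := by
  obtain ⟨j, rfl⟩ := hk
  have e : 2 ^ (2 * j + 1) = 2 * 4 ^ j := by rw [pow_succ', pow_mul]; norm_num
  have := four_pow_mod_three j
  rw [Nat.coprime_comm, Nat.Prime.coprime_iff_not_dvd Nat.prime_three, e]
  omega

theorem three_dvd_two_pow_even_sub_one {k : ℕ} (hk : Even k) : 3 ∣ 2 ^ k - 1 := by
  obtain ⟨j, rfl⟩ := hk
  have e : 2 ^ (j + j) = 4 ^ j := by rw [← two_mul, pow_mul]; norm_num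
  have := four_pow_mod_three j
  rw [e]
  omega

theorem dvd_div_of_coprime {d e N : ℕ} (he : e ∣ N) (hd : d ∣ N) (h : Nat.Coprime d e) :
    d ∣ N / e :=
  Nat.dvd_div_of_mul_dvd (h.symm.mul_dvd_of_dvd_of_dvd he hd)

theorem pow_eq_one_of_pow_eq_one_of_dvd {M : Type*} [Monoid M] {u : M} {d N : ℕ}
    (hu : u ^ d = 1) (h : d ∣ N) : u ^ N = 1 :=
  orderOf_dvd_iff_pow_eq_one.mp ((orderOf_dvd_of_pow_eq_one hu).trans h)

theorem prod_mul_pow_eq_pow {ι M : Type*} [Fintype ι] [CommMonoid M] (c : ι → M) (y : M)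
    (j : ι) (N : ℕ) (hc : ∀ i, i ≠ j → c i ^ N = 1) (hy : y ^ N = 1) :
    ((∏ i, c i) * y) ^ N = c j ^ N := by
  rw [mul_pow, hy, mul_one, ← Finset.prod_pow]
  exact Finset.prod_eq_single j (fun i _ hi => hc i hi) (by simp)

/-- For `ν ≥ 1`, `a ∈ F_{2^n}^*`, `b ∈ F_4^*` and `x ∈ F_{2^n}^*` with polar
decomposition `x = u_1⋯u_ν·y`, one has `f_{a,b}(x) = f_a(u_1) + g_b(u_ν)`. -/
theorem fAB_polar_eval
    {F : Type*} [Field F] [Fintype F]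
    (n ν m : ℕ) (hν : 1 ≤ ν) (hm : Odd m) (hn : n = 2 ^ ν * m)
    (hF : Fintype.card F = 2 ^ n)
    (a b : F) (ha : a ≠ 0) (hb : b ^ 3 = 1) (hb0 : b ≠ 0)
    (x : F) (hx : x ≠ 0) (c : Fin ν → F) (y : F)
    (hc : ∀ i : Fin ν, c i ^ (2 ^ (2 ^ (ν - 1 - (i : ℕ)) * m) + 1) = 1)
    (hy : y ^ 2 ^ m = y) (hy0 : y ≠ 0)
    (hdec : x = (∏ i, c i) * y) :
    fAB n (2 ^ (ν - 1) * m) a b x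
      = fA n (2 ^ (ν - 1) * m) a (c ⟨0, by omega⟩) + gB n b (c ⟨ν - 1, by omega⟩) := by
  have hy1 : y ^ (2 ^ m - 1) = 1 := by
    apply mul_right_cancel₀ hy0
    rw [← pow_succ, Nat.sub_add_cancel Nat.one_le_two_pow, hy, one_mul]
  have hA : x ^ (2 ^ (2 ^ (ν - 1) * m) - 1)
      = c ⟨0, by omega⟩ ^ (2 ^ (2 ^ (ν - 1) * m) - 1) := by
    rw [hdec]
    refine prod_mul_pow_eq_pow c y _ _ (fun i hi => ?_) ?_
    · have hi0 : (i : ℕ) ≠ 0 := fun h => hi (Fin.ext h)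
      exact pow_eq_one_of_pow_eq_one_of_dvd (hc i)
        (two_pow_add_one_dvd_of_lt m (by omega))
    · exact pow_eq_one_of_pow_eq_one_of_dvd hy1
        (Nat.pow_sub_one_dvd_pow_sub_one 2 (Dvd.intro_left _ rfl))
  have heven : Even n := by
    rw [hn]
    exact (even_two.pow_of_ne_zero (by omega)).mul_right m
  have h3 := three_dvd_two_pow_even_sub_one heven
  have hB : chi n x = chi n (c ⟨ν - 1, by omega⟩) := by
    unfold chi
    rw [hdec]
    refine prod_mul_pow_eq_pow c y _ _ (fun i hi => ?_) ?_
    · have hiν : (i : ℕ) ≠ ν - 1 := fun h => hi (Fin.ext h)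
      refine pow_eq_one_of_pow_eq_one_of_dvd (hc i) (dvd_div_of_coprime h3 ?_ ?_)
      · rw [hn]
        exact two_pow_add_one_dvd_of_lt m (by omega)
      · exact coprime_two_pow_even_add_one_three
          ((even_two.pow_of_ne_zero (by omega)).mul_right m)
    · refine pow_eq_one_of_pow_eq_one_of_dvd hy1 (dvd_div_of_coprime h3 ?_ ?_)
      · rw [hn]
        exact Nat.pow_sub_one_dvd_pow_sub_one 2 (Dvd.intro_left _ rfl)
      · exact coprime_two_pow_odd_sub_one_three hm
  simp only [fAB, fA, gB, hA, hB]
end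
end

section
/- For ν ≥ 1, a ∈ F_{2^{m_1}}^*, b ∈ F_4^* and every ω ∈ F_{2^n}^*, the Walsh transform of f_{a,b} satisfies W_{f_{a,b}}(ω) = 1 − ∑_{u ∈ U} (−1)^{f_{a,b}(u)} + 2^m · ∑_{u ∈ U, Tr^n_m(ω·u) = 0} (−1)^{f_{a,b}(u)}. -/
open Finset

attribute [local instance] Classical.propDecidable

noncomputable section

section NatArith

lemma prod_two_pow_add_one_mul (m ν : ℕ) :
    (∏ i ∈ Finset.range ν, (2 ^ (2 ^ i * m) + 1)) * (2 ^ m - 1) = 2 ^ (2 ^ ν * m) - 1 := by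
  induction ν with
  | zero => simp
  | succ k ih =>
    rw [Finset.prod_range_succ, mul_right_comm, ih, mul_comm, ← Nat.sq_sub_sq _ 1, ← pow_mul,
      one_pow, pow_succ]
    congr 2
    ring

lemma coprime_two_pow_add_one_sub_one (k : ℕ) (hk : k ≠ 0) :
    Nat.Coprime (2 ^ k + 1) (2 ^ k - 1) := by
  have h1 : 1 ≤ 2 ^ k := Nat.one_le_two_pow
  have h2 : 2 ^ k + 1 = 2 + (2 ^ k - 1) := by omega
  rw [h2, Nat.coprime_add_self_left, Nat.coprime_two_left, Nat.odd_iff]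
  have : 2 ∣ 2 ^ k := dvd_pow_self 2 hk
  omega

lemma two_pow_sub_one_dvd (m k : ℕ) : 2 ^ m - 1 ∣ 2 ^ (k * m) - 1 := by
  rw [mul_comm, pow_mul]
  simpa using Nat.sub_dvd_pow_sub_pow (2 ^ m) 1 k

lemma coprime_prod_two_pow_add_one (m ν : ℕ) (hm : m ≠ 0) :
    Nat.Coprime (∏ i ∈ Finset.range ν, (2 ^ (2 ^ i * m) + 1)) (2 ^ m - 1) :=
  Nat.Coprime.prod_left fun i _ =>
    (coprime_two_pow_add_one_sub_one (2 ^ i * m) (by positivity)).coprime_dvd_right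
      (two_pow_sub_one_dvd m _)

lemma coprime_two_pow_add_one (m : ℕ) (hm : m ≠ 0) {i j : ℕ} (hij : i ≠ j) :
    Nat.Coprime (2 ^ (2 ^ i * m) + 1) (2 ^ (2 ^ j * m) + 1) := by
  wlog h : j < i generalizing i j
  · exact (this hij.symm (by omega)).symm
  refine (coprime_two_pow_add_one_sub_one (2 ^ i * m) (by positivity)).coprime_dvd_right ?_
  rw [← prod_two_pow_add_one_mul m i]
  exact (Finset.dvd_prod_of_mem _ (Finset.mem_range.2 h)).mul_right _

lemma two_pow_sub_one_dvd_div_three {n ν m : ℕ} (hν : 1 ≤ ν) (hm : Odd m)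
    (hn : n = 2 ^ ν * m) : 2 ^ m - 1 ∣ (2 ^ n - 1) / 3 := by
  obtain ⟨k, rfl⟩ : ∃ k, ν = k + 1 := ⟨ν - 1, by omega⟩
  have h3 : 3 ∣ 2 ^ m + 1 := by
    simpa using hm.nat_add_dvd_pow_add_pow 2 1
  obtain ⟨c, hc⟩ := h3
  refine ⟨(∏ i ∈ Finset.range k, (2 ^ (2 ^ (i + 1) * m) + 1)) * c, ?_⟩
  rw [hn, ← prod_two_pow_add_one_mul, Finset.prod_range_succ', pow_zero, one_mul, hc]
  exact Nat.div_eq_of_eq_mul_left (by norm_num) (by ring)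

end NatArith

section PolarDecomposition

lemma exists_mul_eq_of_pow_mul_eq_one {G : Type*} [CommGroup G] {A B : ℕ}
    (h : Nat.Coprime A B) {g : G} (hg : g ^ (A * B) = 1) :
    ∃ v w : G, v ^ A = 1 ∧ w ^ B = 1 ∧ g = v * w := by
  have hbez := Nat.gcd_eq_gcd_ab A B
  rw [Nat.coprime_iff_gcd_eq_one.1 h] at hbez
  have hz : g ^ ((A : ℤ) * B) = 1 := by
    rw [← Nat.cast_mul, zpow_natCast, hg]
  refine ⟨g ^ ((B : ℤ) * A.gcdB B), g ^ ((A : ℤ) * A.gcdA B), ?_, ?_, ?_⟩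
  · rw [← zpow_natCast, ← zpow_mul, mul_comm, ← mul_assoc, zpow_mul, hz, one_zpow]
  · rw [← zpow_natCast, ← zpow_mul, mul_right_comm, zpow_mul, hz, one_zpow]
  · rw [← zpow_add, add_comm, ← hbez]
    simp

lemma exists_prod_eq_of_pow_prod_eq_one {G ι : Type*} [CommGroup G] [DecidableEq ι]
    (s : Finset ι) (k : ι → ℕ)
    (hk : ∀ i j, i ≠ j → Nat.Coprime (k i) (k j)) (g : G) (hg : g ^ (∏ i ∈ s, k i) = 1) :
    ∃ c : ι → G, (∀ i ∈ s, c i ^ k i = 1) ∧ g = ∏ i ∈ s, c i := by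
  induction s using Finset.induction_on generalizing g with
  | empty => exact ⟨fun _ => 1, by simp, by simpa using hg⟩
  | insert a s ha ih =>
    rw [Finset.prod_insert ha] at hg
    have hcop : Nat.Coprime (k a) (∏ i ∈ s, k i) :=
      Nat.Coprime.prod_right fun i hi => hk a i (by rintro rfl; exact ha hi)
    obtain ⟨v, w, hv, hw, rfl⟩ := exists_mul_eq_of_pow_mul_eq_one hcop hg
    obtain ⟨c, hc, rfl⟩ := ih w hw
    have hne : ∀ i ∈ s, i ≠ a := by rintro i hi rfl; exact ha hi
    refine ⟨Function.update c a v, fun i hi => ?_, ?_⟩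
    · rcases Finset.mem_insert.1 hi with rfl | hi
      · simpa using hv
      · rw [Function.update_of_ne (hne i hi)]
        exact hc i hi
    · rw [Finset.prod_insert ha, Function.update_self]
      congr 1
      exact Finset.prod_congr rfl fun i hi => by rw [Function.update_of_ne (hne i hi)]

variable {F : Type*} [Field F] [Fintype F]

lemma mem_bigU_iff {ν m : ℕ} (hm : m ≠ 0) {u : F} :
    u ∈ bigU F ν m ↔ u ^ (∏ i ∈ Finset.range ν, (2 ^ (2 ^ i * m) + 1)) = 1 := by
  have hM : ∏ i ∈ Finset.range ν, (2 ^ (2 ^ i * m) + 1)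
      = ∏ i : Fin ν, (2 ^ (2 ^ (ν - 1 - (i : ℕ)) * m) + 1) := by
    rw [← Finset.prod_range_reflect, Finset.prod_range]
  rw [hM, bigU, Finset.mem_filter]
  constructor
  · rintro ⟨-, c, hc, rfl⟩
    rw [← Finset.prod_pow]
    refine Finset.prod_eq_one fun i _ => ?_
    obtain ⟨d, hd⟩ := Finset.dvd_prod_of_mem
      (fun i : Fin ν => 2 ^ (2 ^ (ν - 1 - (i : ℕ)) * m) + 1) (Finset.mem_univ i)
    rw [hd, pow_mul, hc, one_pow]
  · intro h
    have hu : u ≠ 0 := by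
      rintro rfl
      rw [zero_pow (Finset.prod_ne_zero_iff.2 fun i _ => by positivity)] at h
      exact zero_ne_one h
    obtain ⟨c, hc, hcu⟩ := exists_prod_eq_of_pow_prod_eq_one Finset.univ
      (fun i : Fin ν => 2 ^ (2 ^ (ν - 1 - (i : ℕ)) * m) + 1)
      (fun i j hij => coprime_two_pow_add_one m hm (by omega)) (Units.mk0 u hu)
      (by ext; simpa using h)
    refine ⟨Finset.mem_univ _, fun i => c i, fun i => ?_, ?_⟩
    · simpa using congrArg Units.val (hc i (Finset.mem_univ i))
    · simpa using congrArg Units.val hcu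

lemma mem_gf_iff {m : ℕ} {y : F} : y ∈ gf F m ↔ y ^ 2 ^ m = y := by
  simp [gf]

lemma mem_gf_erase_zero_iff {m : ℕ} (hm : m ≠ 0) {y : F} :
    y ∈ (gf F m).erase 0 ↔ y ^ (2 ^ m - 1) = 1 := by
  have h1 : 1 < 2 ^ m := Nat.one_lt_two_pow hm
  rw [Finset.mem_erase, mem_gf_iff]
  constructor
  · rintro ⟨h0, h⟩
    apply mul_right_cancel₀ h0
    rw [← pow_succ, one_mul, Nat.sub_add_cancel h1.le, h]
  · intro h
    refine ⟨?_, ?_⟩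
    · rintro rfl
      rw [zero_pow (by omega)] at h
      exact zero_ne_one h
    · rw [← Nat.sub_add_cancel h1.le, pow_succ, h, one_mul]

/-- Summation over `F^*` in polar coordinates. -/
lemma sum_erase_zero_eq_polar {M : Type*} [AddCommMonoid M] {n ν m : ℕ} (hm : m ≠ 0)
    (hn : n = 2 ^ ν * m) (hF : Fintype.card F = 2 ^ n) (g : F → M) :
    ∑ x ∈ Finset.univ.erase 0, g x
      = ∑ u ∈ bigU F ν m, ∑ y ∈ (gf F m).erase 0, g (u * y) := by
  have hcop := coprime_prod_two_pow_add_one m ν hm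
  have hprod := prod_two_pow_add_one_mul m ν
  rw [← hn] at hprod
  rw [← Finset.sum_product']
  symm
  refine Finset.sum_bij (fun p _ => p.1 * p.2) ?_ ?_ ?_ ?_
  · rintro ⟨u, y⟩ h
    obtain ⟨hu, hy⟩ := Finset.mem_product.1 h
    rw [mem_bigU_iff hm] at hu
    refine Finset.mem_erase.2 ⟨mul_ne_zero ?_ (Finset.mem_erase.1 hy).1, Finset.mem_univ _⟩
    rintro h0
    dsimp only at h0 hu
    rw [h0, zero_pow (Finset.prod_ne_zero_iff.2 fun i _ => by positivity)] at hu
    exact zero_ne_one hu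
  · rintro ⟨u, y⟩ h ⟨u', y'⟩ h' heq
    obtain ⟨hu, hy⟩ := Finset.mem_product.1 h
    obtain ⟨hu', hy'⟩ := Finset.mem_product.1 h'
    have hy0 := (Finset.mem_erase.1 hy).1
    have hy0' := (Finset.mem_erase.1 hy').1
    rw [mem_bigU_iff hm] at hu hu'
    rw [mem_gf_erase_zero_iff hm] at hy hy'
    dsimp only at *
    have hq : (y' / y) ^ (1 : ℕ) = 1 := by
      rw [← Nat.coprime_iff_gcd_eq_one.1 hcop]
      refine pow_gcd_eq_one.2 ⟨?_, ?_⟩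
      · have h2 := congrArg (· ^ (∏ i ∈ Finset.range ν, (2 ^ (2 ^ i * m) + 1))) heq
        simp only [mul_pow, hu, hu', one_mul] at h2
        rw [div_pow, ← h2, div_self (pow_ne_zero _ hy0)]
      · rw [div_pow, hy, hy', div_one]
    rw [pow_one, div_eq_one_iff_eq hy0] at hq
    subst hq
    rw [mul_right_cancel₀ hy0 heq]
  · intro x hx
    have hx0 := (Finset.mem_erase.1 hx).1
    have hpow : (Units.mk0 x hx0) ^ ((∏ i ∈ Finset.range ν, (2 ^ (2 ^ i * m) + 1)) * (2 ^ m - 1))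
        = 1 := by
      ext
      rw [hprod, ← hF]
      simpa using FiniteField.pow_card_sub_one_eq_one x hx0
    obtain ⟨v, w, hv, hw, hvw⟩ := exists_mul_eq_of_pow_mul_eq_one hcop hpow
    refine ⟨(v, w), Finset.mem_product.2 ⟨?_, ?_⟩, ?_⟩
    · rw [mem_bigU_iff hm]
      simpa using congrArg Units.val hv
    · rw [mem_gf_erase_zero_iff hm]
      simpa using congrArg Units.val hw
    · simpa using (congrArg Units.val hvw).symm
  · intros
    rfl

lemma card_gf {n m : ℕ} (hm : m ≠ 0) (hmn : m ∣ n) (hF : Fintype.card F = 2 ^ n) :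
    (gf F m).card = 2 ^ m := by
  have hker := IsCyclic.card_powMonoidHom_ker (G := Fˣ) (2 ^ m - 1)
  obtain ⟨k, rfl⟩ := hmn
  rw [Nat.card_units, Nat.card_eq_fintype_card (α := F), hF, Nat.gcd_eq_right
    (by rw [mul_comm]; exact two_pow_sub_one_dvd m k)] at hker
  have hbij : Nat.card (powMonoidHom (2 ^ m - 1) : Fˣ →* Fˣ).ker = ((gf F m).erase 0).card := by
    rw [← Nat.card_eq_finsetCard]
    refine Nat.card_eq_of_bijective (fun x => ⟨(x : Fˣ), ?_⟩) ⟨fun x x' h => ?_, ?_⟩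
    · rw [mem_gf_erase_zero_iff hm]
      simpa using congrArg Units.val (MonoidHom.mem_ker.1 x.2)
    · exact Subtype.ext (Units.ext (congrArg Subtype.val h))
    · rintro ⟨y, hy⟩
      refine ⟨⟨Units.mk0 y (Finset.mem_erase.1 hy).1, ?_⟩, rfl⟩
      rw [mem_gf_erase_zero_iff hm] at hy
      exact MonoidHom.mem_ker.2 (Units.ext (by simpa using hy))
  have h0 : (0 : F) ∈ gf F m := by
    rw [mem_gf_iff, zero_pow (by positivity)]
  have := Finset.card_erase_add_one h0
  have h1 : 1 ≤ 2 ^ m := Nat.one_le_two_pow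
  omega

end PolarDecomposition

section CharTwo

variable {F : Type*} [Field F]

lemma sgn_add {x y : F} [CharP F 2] (hx : x ^ 2 = x) (hy : y ^ 2 = y) :
    sgn (x + y) = sgn x * sgn y := by
  have h01 : ∀ z : F, z ^ 2 = z → z = 0 ∨ z = 1 := fun z hz => by
    have : z * (z - 1) = 0 := by linear_combination hz
    rcases mul_eq_zero.1 this with h | h
    · exact Or.inl h
    · exact Or.inr (sub_eq_zero.1 h)
  rcases h01 x hx with rfl | rfl <;> rcases h01 y hy with rfl | rfl <;>
    simp [sgn, CharTwo.add_self_eq_zero]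

lemma absTr_add [CharP F 2] (k : ℕ) (x y : F) : absTr k (x + y) = absTr k x + absTr k y := by
  simp only [absTr, ← Finset.sum_add_distrib, add_pow_char_pow]

lemma absTr_sq [CharP F 2] {k : ℕ} {x : F} (hx : x ^ 2 ^ k = x) :
    absTr k x ^ 2 = absTr k x := by
  rw [absTr, sum_pow_char]
  simp only [← pow_mul, ← pow_succ]
  have h1 := Finset.sum_range_succ (fun i => x ^ 2 ^ i) k
  rw [Finset.sum_range_succ', hx, pow_zero, pow_one] at h1
  exact add_right_cancel h1

lemma tr2_sq [CharP F 2] {x : F} (hx : x ^ 4 = x) : tr2 x ^ 2 = tr2 x := by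
  rw [tr2, CharTwo.add_sq, ← pow_mul, hx, add_comm]

lemma relTr_pow [CharP F 2] {k j : ℕ} (hj : j ∣ k) {x : F} (hx : x ^ 2 ^ k = x) :
    relTr k j x ^ 2 ^ j = relTr k j x := by
  rw [relTr, sum_pow_char_pow]
  simp only [← pow_mul, ← pow_add]
  have h1 := Finset.sum_range_succ (fun i => x ^ 2 ^ (j * i)) (k / j)
  rw [Finset.sum_range_succ', Nat.mul_div_cancel' hj, hx, mul_zero, pow_zero, pow_one] at h1
  exact add_right_cancel h1

lemma relTr_mul {k j : ℕ} (x : F) {y : F} (hy : y ^ 2 ^ j = y) :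
    relTr k j (x * y) = relTr k j x * y := by
  rw [relTr, relTr, Finset.sum_mul]
  have : ∀ i, y ^ 2 ^ (j * i) = y := fun i => by
    induction i with
    | zero => simp
    | succ i ih => rw [mul_add, mul_one, pow_add, pow_mul, ih, hy]
  exact Finset.sum_congr rfl fun i _ => by rw [mul_pow, this]

lemma absTr_relTr [CharP F 2] {k j : ℕ} (hj : j ∣ k) (x : F) :
    absTr k x = absTr j (relTr k j x) := by
  obtain ⟨c, rfl⟩ := hj
  rcases Nat.eq_zero_or_pos j with rfl | hpos
  · simp [absTr]
  simp only [absTr, relTr, Nat.mul_div_cancel_left c hpos, sum_pow_char_pow, ← pow_mul, ← pow_add]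
  induction c with
  | zero => simp
  | succ c ih =>
    rw [mul_add, mul_one, Finset.sum_range_add, ih]
    simp only [Finset.sum_range_succ, Finset.sum_add_distrib]

lemma exists_absTr_ne_zero [Fintype F] {m : ℕ} (hm : m ≠ 0) (hcard : (gf F m).card = 2 ^ m) :
    ∃ y ∈ gf F m, absTr m y ≠ 0 := by
  by_contra! h
  let p : Polynomial F := ∑ i ∈ Finset.range m, Polynomial.X ^ 2 ^ i
  have hp : p ≠ 0 := by
    intro h0
    have := congrArg (Polynomial.coeff · 1) h0
    simp only [p, Polynomial.finsetSum_coeff, Polynomial.coeff_X_pow, Polynomial.coeff_zero] at this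
    rw [Finset.sum_eq_single 0] at this
    · simp at this
    · intro i _ hi
      rw [if_neg (Nat.one_lt_two_pow hi).ne]
    · simp [hm]
  have hdeg : p.natDegree ≤ 2 ^ (m - 1) := by
    refine Polynomial.natDegree_sum_le_of_forall_le _ _ fun i hi => ?_
    rw [Polynomial.natDegree_X_pow]
    exact Nat.pow_le_pow_right (by norm_num) (by have := Finset.mem_range.1 hi; omega)
  have hle := Polynomial.card_le_degree_of_subset_roots (p := p) (Z := gf F m) fun y hy => by
    rw [Polynomial.mem_roots hp, Polynomial.IsRoot.def]
    simpa [p, Polynomial.eval_finsetSum, absTr] using h y hy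
  have : 2 ^ (m - 1) < 2 ^ m := Nat.pow_lt_pow_right (by norm_num) (by omega)
  omega

lemma sum_gf_sgn_absTr_mul [Fintype F] [CharP F 2] {m : ℕ} (hm : m ≠ 0)
    (hcard : (gf F m).card = 2 ^ m) {t : F} (ht : t ∈ gf F m) :
    ∑ y ∈ gf F m, sgn (absTr m (t * y)) = if t = 0 then 2 ^ m else 0 := by
  split_ifs with h0
  · subst h0
    have : absTr m (0 : F) = 0 := Finset.sum_eq_zero fun i _ => zero_pow (by positivity)
    simp [this, sgn, hcard]
  obtain ⟨z, hz, hz0⟩ := exists_absTr_ne_zero hm hcard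
  rw [mem_gf_iff] at ht hz
  have hneg : ∀ y ∈ gf F m, sgn (absTr m (t * (y + z / t))) = - sgn (absTr m (t * y)) := by
    intro y hy
    rw [mem_gf_iff] at hy
    rw [mul_add, mul_div_cancel₀ _ h0, absTr_add, sgn_add (absTr_sq (by rw [mul_pow, ht, hy]))
      (absTr_sq hz)]
    simp [sgn, hz0]
  have hmem : z / t ∈ gf F m := by rw [mem_gf_iff, div_pow, hz, ht]
  have hadd : ∀ y ∈ gf F m, y + z / t ∈ gf F m := fun y hy => by
    rw [mem_gf_iff] at *
    rw [add_pow_char_pow, hy, hmem]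
  have hinv : ∀ y : F, y + z / t + z / t = y := fun y => by
    rw [add_assoc, CharTwo.add_self_eq_zero, add_zero]
  have hshift : ∑ y ∈ gf F m, sgn (absTr m (t * (y + z / t)))
      = ∑ y ∈ gf F m, sgn (absTr m (t * y)) :=
    Finset.sum_nbij' (· + z / t) (· + z / t) hadd hadd (fun y _ => hinv y) (fun y _ => hinv y)
      fun _ _ => rfl
  rw [Finset.sum_congr rfl hneg, Finset.sum_neg_distrib] at hshift
  omega

end CharTwo

section Binomial

variable {F : Type*} [Field F]

lemma fAB_mul {n ν m : ℕ} (hν : 1 ≤ ν) (hm : Odd m) (hn : n = 2 ^ ν * m) (a b u : F) {y : F}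
    (hy : y ^ (2 ^ m - 1) = 1) :
    fAB n (2 ^ (ν - 1) * m) a b (u * y) = fAB n (2 ^ (ν - 1) * m) a b u := by
  obtain ⟨c, hc⟩ := two_pow_sub_one_dvd m (2 ^ (ν - 1))
  obtain ⟨d, hd⟩ := two_pow_sub_one_dvd_div_three hν hm hn
  simp only [fAB, fA, gB, chi, mul_pow, hc, hd]
  simp only [pow_mul y, hy, one_pow, mul_one]

lemma fAB_sq [Fintype F] [CharP F 2] {n : ℕ} (h3 : 3 ∣ 2 ^ n - 1) (hF : Fintype.card F = 2 ^ n)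
    (m₁ : ℕ) (a b x : F) (hb : b ^ 3 = 1) : fAB n m₁ a b x ^ 2 = fAB n m₁ a b x := by
  have hfrob : ∀ z : F, z ^ 2 ^ n = z := fun z => by rw [← hF, FiniteField.pow_card]
  have hchi : chi n x ^ 4 = chi n x := by
    rw [chi, pow_succ _ 3, ← pow_mul, Nat.div_mul_cancel h3]
    rcases eq_or_ne x 0 with rfl | hx
    · rcases eq_or_ne ((2 ^ n - 1) / 3) 0 with h | h
      · rw [Nat.eq_zero_of_dvd_of_div_eq_zero h3 h]; simp
      · simp [zero_pow h]
    · rw [← hF, FiniteField.pow_card_sub_one_eq_one x hx, one_mul]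
  rw [fAB, fA, gB, CharTwo.add_sq, absTr_sq (hfrob _), tr2_sq]
  rw [mul_pow, hchi, pow_succ, hb, one_mul]

lemma fAB_zero {n m₁ : ℕ} (hm₁ : m₁ ≠ 0) (hn : (2 ^ n - 1) / 3 ≠ 0) (a b : F) :
    fAB n m₁ a b 0 = 0 := by
  have h1 : 2 ^ m₁ - 1 ≠ 0 := by
    have := Nat.one_lt_two_pow hm₁
    omega
  simp [fAB, fA, gB, chi, tr2, absTr, zero_pow h1, zero_pow hn]

end Binomial

/-- For `ν ≥ 1`, `a ∈ F_{2^{m₁}}^*`, `b ∈ F_4^*` and `ω ∈ F_{2^n}^*`,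
`W_{f_{a,b}}(ω) = 1 − ∑_{u ∈ U} (−1)^{f_{a,b}(u)}
  + 2^m · ∑_{u ∈ U, Tr^n_m(ω·u) = 0} (−1)^{f_{a,b}(u)}`. -/
theorem walsh_at_nonzero_polar
    {F : Type*} [Field F] [Fintype F]
    (n ν m : ℕ) (hν : 1 ≤ ν) (hm : Odd m) (hn : n = 2 ^ ν * m)
    (hF : Fintype.card F = 2 ^ n)
    (a b : F) (ha : a ^ 2 ^ (2 ^ (ν - 1) * m) = a) (ha0 : a ≠ 0)
    (hb : b ^ 3 = 1)
    (ω : F) (hω : ω ≠ 0) :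
    walsh n (fAB n (2 ^ (ν - 1) * m) a b) ω
      = 1 - (∑ u ∈ bigU F ν m, sgn (fAB n (2 ^ (ν - 1) * m) a b u))
        + 2 ^ m * ∑ u ∈ (bigU F ν m).filter (fun u => relTr n m (ω * u) = 0),
            sgn (fAB n (2 ^ (ν - 1) * m) a b u) := by
  have hm0 : m ≠ 0 := hm.pos.ne'
  have hmn : m ∣ n := hn ▸ dvd_mul_left m _
  have hchar : CharP F 2 := charP_of_card_eq_prime_pow hF
  have hcard := card_gf hm0 hmn hF
  have hn2 : 2 ∣ n := hn ▸ (dvd_pow_self 2 (by omega)).mul_right m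
  have hn0 : n ≠ 0 := by rw [hn]; positivity
  have h3 : 3 ∣ 2 ^ n - 1 := by
    obtain ⟨k, rfl⟩ := hn2
    simpa [mul_comm] using two_pow_sub_one_dvd 2 k
  have hdiv : (2 ^ n - 1) / 3 ≠ 0 := by
    have := Nat.one_lt_two_pow hn0
    omega
  have hfrob : ∀ z : F, z ^ 2 ^ n = z := fun z => by rw [← hF, FiniteField.pow_card]
  have htr0 : ∀ k, absTr k (0 : F) = 0 := fun k =>
    Finset.sum_eq_zero fun i _ => zero_pow (by positivity)
  set f := fAB n (2 ^ (ν - 1) * m) a b with hf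
  have hzero : f 0 = 0 := fAB_zero (by positivity) hdiv a b
  have hinner : ∀ u, ∑ y ∈ (gf F m).erase 0, sgn (f (u * y) + absTr n (ω * (u * y)))
      = (if relTr n m (ω * u) = 0 then 2 ^ m * sgn (f u) else 0) - sgn (f u) := by
    intro u
    have hterm : ∀ y ∈ (gf F m).erase 0, sgn (f (u * y) + absTr n (ω * (u * y)))
        = sgn (f u) * sgn (absTr m (relTr n m (ω * u) * y)) := by
      intro y hy
      have hy' := mem_gf_iff.1 (Finset.mem_of_mem_erase hy)
      rw [mem_gf_erase_zero_iff hm0] at hy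
      rw [hf, fAB_mul hν hm hn a b u hy, sgn_add (fAB_sq h3 hF _ a b u hb) (absTr_sq (hfrob _)),
        ← mul_assoc ω, absTr_relTr hmn, relTr_mul _ hy']
    have h0 : (0 : F) ∈ gf F m := mem_gf_iff.2 (zero_pow (by positivity))
    have hsum := Finset.add_sum_erase _ (fun y => sgn (absTr m (relTr n m (ω * u) * y))) h0
    rw [sum_gf_sgn_absTr_mul hm0 hcard (mem_gf_iff.2 (relTr_pow hmn (hfrob _))), mul_zero, htr0,
      sgn, if_pos rfl] at hsum
    rw [Finset.sum_congr rfl hterm, ← Finset.mul_sum, eq_sub_of_add_eq' hsum]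
    split_ifs <;> ring
  rw [walsh, ← Finset.add_sum_erase _ _ (Finset.mem_univ 0), mul_zero, htr0, hzero, add_zero,
    sum_erase_zero_eq_polar hm0 hn hF, Finset.sum_congr rfl fun u _ => hinner u,
    Finset.sum_sub_distrib, ← Finset.sum_filter, ← Finset.mul_sum]
  simp only [sgn, if_true]
  ring
end
end
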